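/- Let F₁,…,F_m ∈ K[x₁,…,xₙ] be polynomials generating an ideal I of dimension r, with deg(F₁) ≥ ⋯ ≥ deg(F_m). Then deg(I) ≤ ∏_{i=1}^{n−r} deg(F_i). -/

import Mathlib

open MvPolynomial

/-- The zero set of an ideal of `K[x₁,…,xₙ]` in an algebraic closure of `K`. -/
def zeroSet {K : Type*} [Field K] {n : ℕ} (I : Ideal (MvPolynomial (Fin n) K)) :
    Set (Fin n → AlgebraicClosure K) :=
  {x | ∀ f ∈ I, MvPolynomial.aeval x f = 0}

/-- The degree of a prime ideal `P` of dimension `d`: the maximal (finite) number of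
intersection points of `V(P)` with `d` affine hyperplanes, whenever that
intersection is finite. -/
noncomputable def primeDeg {K : Type*} [Field K] {n : ℕ}
    (P : Ideal (MvPolynomial (Fin n) K)) (d : ℕ) : ℕ∞ :=
  sSup {N : ℕ∞ | ∃ (c : Fin d → Fin n → AlgebraicClosure K)
      (c₀ : Fin d → AlgebraicClosure K),
    (zeroSet P ∩ {x | ∀ i, c₀ i + ∑ j, c i j * x j = 0}).Finite ∧
    N = Nat.card ↥(zeroSet P ∩ {x | ∀ i, c₀ i + ∑ j, c i j * x j = 0})}

/-- The degree of an ideal `I` of dimension `r`: the sum of the degrees of the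
irreducible components of `V(I)` of dimension `r`, i.e. of the minimal primes
over `I` whose quotient has Krull dimension `r`. -/
noncomputable def idealDeg {K : Type*} [Field K] {n : ℕ}
    (I : Ideal (MvPolynomial (Fin n) K)) (r : ℕ) : ℕ∞ :=
  ∑ᶠ P ∈ {P : Ideal (MvPolynomial (Fin n) K) |
    P ∈ I.minimalPrimes ∧ ringKrullDim (MvPolynomial (Fin n) K ⧸ P) = r},
    primeDeg P r

section HilbertFunction

variable {k : Type*} [Field k] {n : ℕ}

/-- The affine Hilbert function of an ideal: the dimension of the space of polynomials of degree
at most `t` modulo the ideal. -/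
noncomputable def affineHilb (J : Ideal (MvPolynomial (Fin n) k)) (t : ℕ) : ℕ :=
  Module.finrank k
    ((restrictTotalDegree (Fin n) k t).map (Ideal.Quotient.mkₐ k J).toLinearMap)

theorem finrank_restrictTotalDegree (t : ℕ) :
    Module.finrank k (restrictTotalDegree (Fin n) k t) = (n + t).choose n := by
  classical
  have key : ∀ s : ℕ, Nat.card {α : Fin n →₀ ℕ | (α.sum fun _ e => e) ≤ s} = (n + s).choose n := by
    intro s
    have hset : {α : Fin n →₀ ℕ | (α.sum fun _ e => e) ≤ s} =
        ((Finset.range (s + 1)).biUnion fun j => Finset.univ.finsuppAntidiag j :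
          Finset (Fin n →₀ ℕ)) := by
      ext α
      simp [Finset.mem_finsuppAntidiag, Finsupp.sum_fintype]
    rw [hset, Nat.card_coe_set_eq, Set.ncard_coe_finset, Finset.card_biUnion]
    · simp only [Finset.card_finsuppAntidiag_nat_eq_multichoose, Finset.card_univ,
        Fintype.card_fin]
      clear hset
      induction s with
      | zero => simp
      | succ s ih =>
        rw [Finset.sum_range_succ, ih, Nat.multichoose_eq, Nat.choose_symm_add, ← add_assoc,
          Nat.add_sub_cancel, ← Nat.choose_succ_succ' (n + s) s, Nat.add_assoc,
          Nat.choose_symm_add]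
    · intro i _ j _ hij
      rw [Function.onFun, Finset.disjoint_left]
      intro α hα hα'
      simp only [Finset.mem_finsuppAntidiag] at hα hα'
      exact hij (hα.1.symm.trans hα'.1)
  rw [← key t]
  exact Module.finrank_eq_nat_card_basis (basisRestrictSupport k _)

theorem affineHilb_le_choose (J : Ideal (MvPolynomial (Fin n) k)) (t : ℕ) :
    affineHilb J t ≤ (n + t).choose n := by
  rw [affineHilb, ← finrank_restrictTotalDegree (k := k)]
  exact Submodule.finrank_map_le _ _

theorem affineHilb_anti {J J' : Ideal (MvPolynomial (Fin n) k)} (h : J ≤ J') (t : ℕ) :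
    affineHilb J' t ≤ affineHilb J t := by
  have : (restrictTotalDegree (Fin n) k t).map (Ideal.Quotient.mkₐ k J').toLinearMap =
      ((restrictTotalDegree (Fin n) k t).map (Ideal.Quotient.mkₐ k J).toLinearMap).map
        (Ideal.Quotient.factorₐ k h).toLinearMap := by
    rw [← Submodule.map_comp]
    rfl
  rw [affineHilb, this]
  exact Submodule.finrank_map_le _ _

theorem affineHilb_add_le {J J' : Ideal (MvPolynomial (Fin n) k)} (h : J ≤ J')
    {G : MvPolynomial (Fin n) k} (hG : G ∈ J') (hreg : ∀ f, G * f ∈ J → f ∈ J)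
    {d : ℕ} (hd : G.totalDegree ≤ d) (t : ℕ) :
    affineHilb J' (t + d) + affineHilb J t ≤ affineHilb J (t + d) := by
  set V := (restrictTotalDegree (Fin n) k (t + d)).map (Ideal.Quotient.mkₐ k J).toLinearMap
    with hV
  set W := (restrictTotalDegree (Fin n) k t).map (Ideal.Quotient.mkₐ k J).toLinearMap with hW
  let π := (Ideal.Quotient.factorₐ k h).toLinearMap
  have hJ' : (restrictTotalDegree (Fin n) k (t + d)).map (Ideal.Quotient.mkₐ k J').toLinearMap =
      V.map π := by
    rw [hV, ← Submodule.map_comp]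
    rfl
  let μ : (MvPolynomial (Fin n) k ⧸ J) →ₗ[k] (MvPolynomial (Fin n) k ⧸ J) :=
    LinearMap.mulLeft k (Ideal.Quotient.mk J G)
  have hμ : Function.Injective μ := by
    rw [← LinearMap.ker_eq_bot, LinearMap.ker_eq_bot']
    intro x hx
    obtain ⟨f, rfl⟩ := Ideal.Quotient.mk_surjective x
    rw [LinearMap.mulLeft_apply, ← map_mul, Ideal.Quotient.eq_zero_iff_mem] at hx
    exact Ideal.Quotient.eq_zero_iff_mem.mpr (hreg f hx)
  have hWV : W.map μ ≤ V := by
    rintro _ ⟨_, ⟨f, hf, rfl⟩, rfl⟩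
    refine ⟨G * f, ?_, by simp [μ]⟩
    rw [SetLike.mem_coe, mem_restrictTotalDegree] at hf ⊢
    exact (totalDegree_mul _ _).trans (by omega)
  have hWk : W.map μ ≤ LinearMap.ker π := by
    rintro _ ⟨_, ⟨f, hf, rfl⟩, rfl⟩
    have : Ideal.Quotient.mk J' (G * f) = 0 :=
      Ideal.Quotient.eq_zero_iff_mem.mpr (J'.mul_mem_right _ hG)
    simpa [μ, π, ← map_mul] using this
  have h1 := LinearMap.finrank_range_add_finrank_ker (π.domRestrict V)
  rw [LinearMap.range_domRestrict] at h1
  have h2 : Module.finrank k W ≤ Module.finrank k (LinearMap.ker (π.domRestrict V)) := by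
    refine LinearMap.finrank_le_finrank_of_injective
      (f := ((μ.restrict (p := W) (q := V) fun x hx => hWV ⟨x, hx, rfl⟩).codRestrict _ ?_)) ?_
    · intro x
      exact hWk ⟨x, x.2, rfl⟩
    · intro x y hxy
      have : μ x = μ y := congrArg (fun z => ((z : V) : MvPolynomial (Fin n) k ⧸ J))
        (congrArg Subtype.val hxy)
      exact Subtype.ext (hμ this)
  change Module.finrank k (Submodule.map _ _) + Module.finrank k W ≤ Module.finrank k V
  rw [hJ']
  omega

/-- The Hilbert function of `J` grows at least like `(e / D) t ^ r / r!`. -/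
def HilbGrowth (J : Ideal (MvPolynomial (Fin n) k)) (r e D : ℕ) : Prop :=
  ∃ δ, ∀ t, e * t ^ r ≤ D * r.factorial * affineHilb J (t + δ)

theorem HilbGrowth.anti {J J' : Ideal (MvPolynomial (Fin n) k)} (h : J ≤ J') {r e D : ℕ}
    (hJ' : HilbGrowth J' r e D) : HilbGrowth J r e D := by
  obtain ⟨δ, hδ⟩ := hJ'
  exact ⟨δ, fun t => (hδ t).trans (Nat.mul_le_mul_left _ (affineHilb_anti h _))⟩

theorem HilbGrowth.le {r e D : ℕ} {J : Ideal (MvPolynomial (Fin r) k)}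
    (h : HilbGrowth J r e D) : e ≤ D := by
  obtain ⟨δ, hδ⟩ := h
  have hbound : ∀ t : ℕ, e * t ^ r ≤ D * (t + (δ + r)) ^ r := fun t => by
    refine (hδ t).trans ?_
    rw [mul_assoc]
    refine Nat.mul_le_mul_left _ ?_
    calc r.factorial * affineHilb J (t + δ)
        ≤ r.factorial * (r + (t + δ)).choose r := Nat.mul_le_mul_left _ (affineHilb_le_choose _ _)
      _ = (r + (t + δ)).descFactorial r := (Nat.descFactorial_eq_factorial_mul_choose _ _).symm
      _ ≤ (r + (t + δ)) ^ r := Nat.descFactorial_le_pow _ _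
      _ = (t + (δ + r)) ^ r := by ring
  have hlim : Filter.Tendsto (fun t : ℕ => (D : ℝ) * (1 + (δ + r : ℕ) * (t : ℝ)⁻¹) ^ r)
      Filter.atTop (nhds ((D : ℝ) * (1 + (δ + r : ℕ) * 0) ^ r)) :=
    (((tendsto_inv_atTop_nhds_zero_nat (𝕜 := ℝ)).const_mul _).const_add _).pow _ |>.const_mul _
  have : (e : ℝ) ≤ (D : ℝ) * (1 + (δ + r : ℕ) * 0) ^ r := by
    refine ge_of_tendsto hlim ?_
    filter_upwards [Filter.eventually_gt_atTop 0] with t ht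
    have ht' : (0 : ℝ) < t := by exact_mod_cast ht
    have h1 : (e : ℝ) * t ^ r ≤ D * (t + (δ + r : ℕ)) ^ r := by exact_mod_cast hbound t
    have h2 : (t + (δ + r : ℕ) : ℝ) = (1 + (δ + r : ℕ) * (t : ℝ)⁻¹) * t := by field_simp
    rw [h2, mul_pow, ← mul_assoc] at h1
    exact le_of_mul_le_mul_right h1 (by positivity)
  exact_mod_cast (by simpa using this : (e : ℝ) ≤ D)

theorem pow_succ_le_mul_sum_pow (r N : ℕ) :
    N ^ (r + 1) ≤ (r + 1) * ∑ i ∈ Finset.range N, (i + 1) ^ r := by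
  induction N with
  | zero => simp
  | succ N ih =>
    rw [Finset.sum_range_succ, mul_add]
    refine le_trans ?_ (Nat.add_le_add_right ih _)
    have key : ∀ s : ℕ, (N + 1) ^ (s + 1) ≤ N ^ (s + 1) + (s + 1) * (N + 1) ^ s := by
      intro s
      induction s with
      | zero => simp
      | succ s ihs =>
        calc (N + 1) ^ (s + 1 + 1) = N * (N + 1) ^ (s + 1) + (N + 1) ^ (s + 1) := by ring
          _ ≤ N * (N ^ (s + 1) + (s + 1) * (N + 1) ^ s) + (N + 1) ^ (s + 1) := by gcongr
          _ = N ^ (s + 1 + 1) + (s + 1) * (N * (N + 1) ^ s) + (N + 1) ^ (s + 1) := by ring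
          _ ≤ N ^ (s + 1 + 1) + (s + 1) * ((N + 1) * (N + 1) ^ s) + (N + 1) ^ (s + 1) := by
            gcongr; omega
          _ = _ := by ring
    exact key r

theorem HilbGrowth.of_regular {J J' : Ideal (MvPolynomial (Fin n) k)} (h : J ≤ J')
    {G : MvPolynomial (Fin n) k} (hG : G ∈ J') (hreg : ∀ f, G * f ∈ J → f ∈ J)
    {d : ℕ} (hd : G.totalDegree ≤ d) {r e D : ℕ} (hJ' : HilbGrowth J' r e D) :
    HilbGrowth J (r + 1) e (D * d) := by
  obtain ⟨δ, hδ⟩ := hJ'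
  have hstep := affineHilb_add_le h hG hreg hd
  rcases Nat.eq_zero_or_pos d with rfl | hpos
  · have h1 := hδ 1
    have h2 := hstep (1 + δ)
    have h3 : affineHilb J' (1 + δ) = 0 := by simpa using h2
    have : e = 0 := by simpa [h3] using h1
    exact ⟨0, by simp [this]⟩
  have htel : ∀ s N : ℕ, ∑ i ∈ Finset.range N, affineHilb J' (s + i * d + d) ≤
      affineHilb J (s + N * d) := by
    intro s N
    induction N with
    | zero => simp
    | succ N ih =>
      rw [Finset.sum_range_succ]
      have := hstep (s + N * d)
      rw [show s + (N + 1) * d = s + N * d + d by ring]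
      omega
  refine ⟨δ + d, fun t => ?_⟩
  obtain ⟨N, s, hs, hN⟩ : ∃ N s, t + d = s + N * d ∧ t ≤ N * d :=
    ⟨(t + d) / d, (t + d) % d, by rw [mul_comm, Nat.mod_add_div], by
      have := Nat.mod_lt (t + d) hpos
      have h2 := Nat.mod_add_div (t + d) d
      rw [mul_comm] at h2
      omega⟩
  have hsum : e * (d ^ r * ∑ i ∈ Finset.range N, (i + 1) ^ r) ≤
      D * r.factorial * affineHilb J (t + (δ + d)) := by
    rw [show t + (δ + d) = s + δ + N * d by omega]
    refine le_trans ?_ (Nat.mul_le_mul_left _ (htel (s + δ) N))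
    rw [Finset.mul_sum, Finset.mul_sum, Finset.mul_sum]
    refine Finset.sum_le_sum fun i _ => ?_
    have := hδ (s + i * d + d)
    rw [show s + i * d + d + δ = s + δ + i * d + d by omega] at this
    refine le_trans (Nat.mul_le_mul_left _ ?_) this
    rw [← mul_pow]
    gcongr
    nlinarith
  calc e * t ^ (r + 1) ≤ e * (N * d) ^ (r + 1) := by gcongr
    _ = d * (e * d ^ r) * N ^ (r + 1) := by ring
    _ ≤ d * (e * d ^ r) * ((r + 1) * ∑ i ∈ Finset.range N, (i + 1) ^ r) :=
      Nat.mul_le_mul_left _ (pow_succ_le_mul_sum_pow r N)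
    _ = d * (r + 1) * (e * (d ^ r * ∑ i ∈ Finset.range N, (i + 1) ^ r)) := by ring
    _ ≤ d * (r + 1) * (D * r.factorial * affineHilb J (t + (δ + d))) :=
      Nat.mul_le_mul_left _ hsum
    _ = D * d * (r + 1).factorial * affineHilb J (t + (δ + d)) := by
      rw [Nat.factorial_succ]; ring

end HilbertFunction

section Dimension

theorem MvPolynomial.height_eq_of_isMaximal {k : Type*} [Field k] (n : ℕ)
    (m : Ideal (MvPolynomial (Fin n) k)) [m.IsMaximal] : m.height = n := by
  induction n with
  | zero =>
    have h := Ideal.height_le_ringKrullDim_of_isPrime (I := m)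
    rw [MvPolynomial.ringKrullDim_of_isNoetherianRing, ringKrullDim_eq_zero_of_field] at h
    have : m.height ≤ 0 := by simpa using h
    simpa using this
  | succ n ih =>
    let e := (finSuccEquiv k n).toRingEquiv
    obtain ⟨P, hP⟩ : ∃ P : Ideal (Polynomial (MvPolynomial (Fin n) k)), P = m.map e := ⟨_, rfl⟩
    have hmax : P.IsMaximal := hP ▸ Ideal.map_isMaximal_of_equiv e
    have hmax' : (P.comap (Polynomial.C : MvPolynomial (Fin n) k →+* _)).IsMaximal :=
      Polynomial.isMaximal_comap_C_of_isJacobsonRing P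
    have : P.LiesOver (P.comap (Polynomial.C : MvPolynomial (Fin n) k →+* _)) := ⟨rfl⟩
    have := Polynomial.height_eq_height_add_one (P.comap Polynomial.C) P
    rw [← e.height_map m, ← hP, this, ih]
    simp

theorem Ideal.height_map_quotientMk_le_ringKrullDim {A : Type*} [CommRing A] [IsNoetherianRing A]
    {J Q m : Ideal A} [m.IsPrime] [Q.IsPrime] (hJm : J ≤ m)
    (h : ∀ q ∈ J.minimalPrimes, q ≤ m → q = Q) :
    ((m.map (Ideal.Quotient.mk J)).height : WithBot ℕ∞) ≤ ringKrullDim (A ⧸ Q) := by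
  have hprime : (m.map (Ideal.Quotient.mk J)).IsPrime := Ideal.isPrime_map_quotientMk_of_isPrime hJm
  obtain ⟨l, hl, hlen⟩ := (m.map (Ideal.Quotient.mk J)).exists_ltSeries_length_eq_height
  have hcomap : (m.map (Ideal.Quotient.mk J)).comap (Ideal.Quotient.mk J) = m := by
    rw [Ideal.comap_map_of_surjective' _ Ideal.Quotient.mk_surjective, Ideal.mk_ker,
      sup_eq_left.mpr hJm]
  have hQ : ∀ i, Q ≤ (l i).asIdeal.comap (Ideal.Quotient.mk J) := by
    intro i
    have hJ : J ≤ (l i).asIdeal.comap (Ideal.Quotient.mk J) := by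
      conv_lhs => rw [← Ideal.mk_ker (I := J)]
      exact Ideal.comap_mono bot_le
    obtain ⟨q, hq, hqi⟩ := Ideal.exists_minimalPrimes_le hJ
    have him : (l i).asIdeal.comap (Ideal.Quotient.mk J) ≤ m := by
      have h1 : l i ≤ l.last := LTSeries.monotone l (Fin.le_last i)
      rw [hl] at h1
      rw [← hcomap]
      exact Ideal.comap_mono h1
    rwa [← h q hq (hqi.trans him)]
  have hcm : ∀ i, (((l i).asIdeal.comap (Ideal.Quotient.mk J)).map (Ideal.Quotient.mk Q)).comap
      (Ideal.Quotient.mk Q) = (l i).asIdeal.comap (Ideal.Quotient.mk J) := fun i => by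
    rw [Ideal.comap_map_of_surjective' _ Ideal.Quotient.mk_surjective, Ideal.mk_ker,
      sup_eq_left.mpr (hQ i)]
  let l' : LTSeries (PrimeSpectrum (A ⧸ Q)) :=
    { length := l.length
      toFun := fun i => ⟨((l i).asIdeal.comap (Ideal.Quotient.mk J)).map (Ideal.Quotient.mk Q),
        Ideal.isPrime_map_quotientMk_of_isPrime (hQ i)⟩
      step := fun i => by
        have hlt : l i.castSucc < l i.succ := l.step i
        refine lt_of_le_not_ge (Ideal.map_mono (Ideal.comap_mono hlt.le)) fun hle => hlt.not_ge ?_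
        have := Ideal.comap_mono (f := Ideal.Quotient.mk Q) hle
        rw [hcm, hcm] at this
        exact (Ideal.comap_le_comap_iff_of_surjective _ Ideal.Quotient.mk_surjective _ _).mp this }
  rw [← hlen]
  exact Order.LTSeries.length_le_krullDim l'

theorem MvPolynomial.natCast_le_card_add_ringKrullDim {k : Type*} [Field k] {n : ℕ}
    {S : Finset (MvPolynomial (Fin n) k)} {Q : Ideal (MvPolynomial (Fin n) k)}
    (hQ : Q ∈ (Ideal.span (S : Set (MvPolynomial (Fin n) k))).minimalPrimes) :
    (n : WithBot ℕ∞) ≤ ringKrullDim (MvPolynomial (Fin n) k ⧸ Q) + S.card := by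
  classical
  set J := Ideal.span (S : Set (MvPolynomial (Fin n) k)) with hJ
  have hQp : Q.IsPrime := hQ.1.1
  have hfin := Ideal.finite_minimalPrimes_of_isNoetherianRing _ J
  have hnot : ¬ (hfin.toFinset.erase Q).inf id ≤ Q := by
    rw [Ideal.IsPrime.inf_le' hQp]
    rintro ⟨q, hq, hqQ⟩
    simp only [Finset.mem_erase, Set.Finite.mem_toFinset] at hq
    exact hq.1 (le_antisymm hqQ (hQ.2 hq.2.1 hqQ))
  obtain ⟨f, hf, hfQ⟩ := SetLike.not_le_iff_exists.mp hnot
  obtain ⟨m, hQm, hm, hfm⟩ : ∃ m : Ideal (MvPolynomial (Fin n) k), Q ≤ m ∧ m.IsMaximal ∧ f ∉ m := by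
    have h : f ∉ Q.jacobson := by
      rwa [← Ideal.radical_eq_jacobson, hQp.radical]
    simpa [Ideal.jacobson, Submodule.mem_sInf, and_assoc] using h
  have hJm : J ≤ m := hQ.1.2.trans hQm
  have h1 := Ideal.height_le_height_add_encard_of_subset (S : Set (MvPolynomial (Fin n) k))
    (p := m) (Ideal.span_le.mp hJm)
  rw [MvPolynomial.height_eq_of_isMaximal, Set.encard_coe_eq_coe_finsetCard] at h1
  have h2 := Ideal.height_map_quotientMk_le_ringKrullDim (Q := Q) hJm fun q hq hqm => by
    by_contra hne
    have : f ∈ q := (Finset.inf_le (f := id) (Finset.mem_erase.mpr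
      ⟨hne, hfin.mem_toFinset.mpr hq⟩) : _ ≤ q) hf
    exact hfm (hqm this)
  calc (n : WithBot ℕ∞) = ((n : ℕ∞) : WithBot ℕ∞) := rfl
    _ ≤ (((m.map (Ideal.Quotient.mk J)).height + (S.card : ℕ∞) : ℕ∞) : WithBot ℕ∞) :=
      WithBot.coe_le_coe.mpr h1
    _ = ((m.map (Ideal.Quotient.mk J)).height : WithBot ℕ∞) + S.card := by push_cast; rfl
    _ ≤ _ := by gcongr

end Dimension

section UpperBound

variable {k : Type*} [Field k] {n : ℕ}

theorem exists_linearCombination_notMem [Infinite k] {m : ℕ} (F : Fin m → MvPolynomial (Fin n) k)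
    (i : Fin m) (T : Set (Ideal (MvPolynomial (Fin n) k))) (hT : T.Finite)
    (h : ∀ Q ∈ T, ∃ l, i ≤ l ∧ F l ∉ Q) :
    ∃ c : Fin m → k, c i ≠ 0 ∧ ∀ Q ∈ T, ∑ l ∈ Finset.Ici i, C (c l) * F l ∉ Q := by
  classical
  let φ : (Fin m → k) →ₗ[k] MvPolynomial (Fin n) k :=
    ∑ l ∈ Finset.Ici i, (LinearMap.proj l : (Fin m → k) →ₗ[k] k).smulRight (F l)
  have hφ : ∀ c, φ c = ∑ l ∈ Finset.Ici i, C (c l) * F l := fun c => by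
    simp [φ, LinearMap.sum_apply, smul_eq_C_mul]
  let s : Finset (Subspace k (Fin m → k)) :=
    insert (LinearMap.ker (LinearMap.proj i : (Fin m → k) →ₗ[k] k))
      (hT.toFinset.image fun Q => (Q.restrictScalars k).comap φ)
  have hs : ⊤ ∉ s := by
    simp only [s, Finset.mem_insert, Finset.mem_image, Set.Finite.mem_toFinset, not_or, not_exists,
      not_and]
    constructor
    · intro h0
      have : Pi.single i (1 : k) ∈ LinearMap.ker (LinearMap.proj i : (Fin m → k) →ₗ[k] k) :=
        h0 ▸ Submodule.mem_top
      simp at this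
    · intro Q hQ htop
      obtain ⟨l, hl, hlQ⟩ := h Q hQ
      have : Pi.single l (1 : k) ∈ (Q.restrictScalars k).comap φ := htop ▸ Submodule.mem_top
      rw [Submodule.mem_comap, Submodule.restrictScalars_mem, hφ,
        Finset.sum_eq_single l (fun j _ hj => by simp [hj]) (by simp [hl])] at this
      exact hlQ (by simpa using this)
  obtain ⟨c, hc⟩ := (Set.ne_univ_iff_exists_notMem _).mp (Subspace.biUnion_ne_univ_of_top_notMem hs)
  simp only [s, Finset.mem_insert, Finset.mem_image, Set.Finite.mem_toFinset, Set.mem_iUnion,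
    not_exists, SetLike.mem_coe] at hc
  refine ⟨c, fun h0 => hc _ (Or.inl rfl) (by simpa using h0), fun Q hQ hmem => ?_⟩
  exact hc _ (Or.inr ⟨Q, hQ, rfl⟩) (by simpa [hφ] using hmem)

theorem mem_radical_of_mul_mem {J : Ideal (MvPolynomial (Fin n) k)} {G f : MvPolynomial (Fin n) k}
    (hG : ∀ Q ∈ J.minimalPrimes, G ∉ Q) (h : G * f ∈ J.radical) : f ∈ J.radical := by
  rw [← Ideal.sInf_minimalPrimes, Submodule.mem_sInf] at h ⊢
  exact fun Q hQ => (hQ.1.1.mem_or_mem (h Q hQ)).resolve_left (hG Q hQ)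

theorem exists_generic_system [Infinite k] {m r : ℕ} (F : Fin m → MvPolynomial (Fin n) k)
    (hm : n - r ≤ m)
    (hdim : ringKrullDim (MvPolynomial (Fin n) k ⧸ Ideal.span (Set.range F)) ≤ r)
    (hsorted : ∀ i j : Fin m, i ≤ j → (F j).totalDegree ≤ (F i).totalDegree)
    (i : ℕ) (hi : i ≤ n - r) :
    ∃ S : Finset (MvPolynomial (Fin n) k), S.card ≤ i ∧
      Ideal.span S ≤ Ideal.span (Set.range F) ∧
      (∀ l : Fin m, (l : ℕ) < i → F l ∈ Ideal.span S ⊔ Ideal.span (F '' {l | i ≤ (l : ℕ)})) ∧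
      ∀ e D, HilbGrowth (Ideal.span (S : Set (MvPolynomial (Fin n) k))).radical (n - i) e D →
        HilbGrowth (⊥ : Ideal (MvPolynomial (Fin n) k)) n e
          (D * ∏ j : Fin i, (F (Fin.castLE (hi.trans hm) j)).totalDegree) := by
  classical
  induction i with
  | zero =>
    refine ⟨∅, by simp, by simp, by simp, fun e D h => ?_⟩
    simpa using h.anti bot_le
  | succ i ih =>
    obtain ⟨S, hcard, hSI, hIS, hgrowth⟩ := ih (by omega)
    let i' : Fin m := ⟨i, by omega⟩
    set J := Ideal.span (S : Set (MvPolynomial (Fin n) k)) with hJ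
    have hI : Ideal.span (Set.range F) ≤ J ⊔ Ideal.span (F '' {l | i ≤ (l : ℕ)}) := by
      rw [Ideal.span_le]
      rintro _ ⟨l, rfl⟩
      rcases lt_or_ge (l : ℕ) i with hl | hl
      · exact hIS l hl
      · exact Ideal.mem_sup_right (Ideal.subset_span ⟨l, hl, rfl⟩)
    obtain ⟨c, hc, hcQ⟩ := exists_linearCombination_notMem F i' J.minimalPrimes
      (Ideal.finite_minimalPrimes_of_isNoetherianRing _ J) fun Q hQ => by
        by_contra! hall
        have hIQ : Ideal.span (Set.range F) ≤ Q := hI.trans <| sup_le hQ.1.2 <| by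
          rw [Ideal.span_le]
          rintro _ ⟨l, hl, rfl⟩
          exact hall l hl
        have h1 := MvPolynomial.natCast_le_card_add_ringKrullDim hQ
        have h2 : ringKrullDim (MvPolynomial (Fin n) k ⧸ Q) ≤ r :=
          (ringKrullDim_le_of_surjective (Ideal.Quotient.factor hIQ)
            (Ideal.Quotient.factor_surjective hIQ)).trans hdim
        have h3 : (n : WithBot ℕ∞) ≤ (r : WithBot ℕ∞) + S.card := h1.trans (by gcongr)
        have h4 : n ≤ r + S.card := by exact_mod_cast h3
        omega
    set G := ∑ l ∈ Finset.Ici i', C (c l) * F l with hG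
    refine ⟨insert G S, (Finset.card_insert_le _ _).trans (by omega), ?_, ?_, fun e D h => ?_⟩
    · rw [Ideal.span_le, Finset.coe_insert, Set.insert_subset_iff]
      refine ⟨Ideal.sum_mem _ fun l _ => Ideal.mul_mem_left _ _ (Ideal.subset_span ⟨l, rfl⟩), ?_⟩
      exact Ideal.span_le.mp hSI
    · set T := Ideal.span ((insert G S : Finset _) : Set (MvPolynomial (Fin n) k)) ⊔
        Ideal.span (F '' {l | i + 1 ≤ (l : ℕ)}) with hT
      have hJT : J ≤ T := le_sup_of_le_left (Ideal.span_mono (by simp))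
      have htail : ∀ l : Fin m, i + 1 ≤ (l : ℕ) → F l ∈ T := fun l hl =>
        Ideal.mem_sup_right (Ideal.subset_span ⟨l, hl, rfl⟩)
      have hGT : G ∈ T := Ideal.mem_sup_left (Ideal.subset_span (by simp))
      have hFi : F i' ∈ T := by
        have hsum : G = C (c i') * F i' + ∑ l ∈ (Finset.Ici i').erase i', C (c l) * F l :=
          (Finset.add_sum_erase _ _ (by simp)).symm
        have h1 : ∑ l ∈ (Finset.Ici i').erase i', C (c l) * F l ∈ T := by
          refine Ideal.sum_mem _ fun l hl => Ideal.mul_mem_left _ _ (htail l ?_)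
          simp only [Finset.mem_erase, Finset.mem_Ici] at hl
          exact lt_of_le_of_ne hl.2 (Ne.symm hl.1)
        have h2 : C (c i') * F i' ∈ T := by
          rw [eq_sub_of_add_eq hsum.symm]
          exact T.sub_mem hGT h1
        have h3 := T.mul_mem_left (C (c i')⁻¹) h2
        rwa [← mul_assoc, ← C_mul, inv_mul_cancel₀ hc, C_1, one_mul] at h3
      have hle : J ⊔ Ideal.span (F '' {l | i ≤ (l : ℕ)}) ≤ T := by
        refine sup_le hJT ?_
        rw [Ideal.span_le]
        rintro _ ⟨l, hl, rfl⟩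
        rcases Nat.eq_or_lt_of_le (show i ≤ (l : ℕ) from hl) with h | h
        · obtain rfl : i' = l := Fin.ext h
          exact hFi
        · exact htail l h
      exact fun l _ => hle (hI (Ideal.subset_span ⟨l, rfl⟩))
    · have hdeg : G.totalDegree ≤ (F i').totalDegree := by
        refine totalDegree_finsetSum_le fun l hl => ?_
        refine (totalDegree_mul _ _).trans ?_
        rw [totalDegree_C, zero_add]
        exact hsorted _ _ (Finset.mem_Ici.mp hl)
      have hstep := h.of_regular (J := J.radical) (G := G)
        (Ideal.radical_mono (Ideal.span_mono (by simp)))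
        (Ideal.le_radical (Ideal.subset_span (by simp)))
        (fun f hf => mem_radical_of_mul_mem hcQ hf) hdeg
      rw [show n - (i + 1) + 1 = n - i by omega] at hstep
      have := hgrowth _ _ hstep
      rw [Fin.prod_univ_castSucc]
      convert this using 1
      rw [mul_assoc, mul_comm (F i').totalDegree]
      rfl

theorem HilbGrowth.le_prod_totalDegree [Infinite k] {m r : ℕ}
    (F : Fin m → MvPolynomial (Fin n) k) (hr : r ≤ n) (hm : n - r ≤ m)
    (hdim : ringKrullDim (MvPolynomial (Fin n) k ⧸ Ideal.span (Set.range F)) ≤ r)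
    (hsorted : ∀ i j : Fin m, i ≤ j → (F j).totalDegree ≤ (F i).totalDegree) {e : ℕ}
    (h : HilbGrowth (Ideal.span (Set.range F)).radical r e 1) :
    e ≤ ∏ i : Fin (n - r), (F (Fin.castLE hm i)).totalDegree := by
  obtain ⟨S, -, hSI, -, hgrowth⟩ := exists_generic_system F hm hdim hsorted (n - r) le_rfl
  rw [Nat.sub_sub_self hr] at hgrowth
  simpa using (hgrowth e 1 (h.anti (Ideal.radical_mono hSI))).le

end UpperBound

section LyingOver

theorem ringKrullDim_le_of_isIntegral {A B : Type*} [CommRing A] [CommRing B] (f : A →+* B)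
    (hf : f.IsIntegral) : ringKrullDim B ≤ ringKrullDim A := by
  algebraize [f]
  refine Order.krullDim_le_of_strictMono (PrimeSpectrum.comap (algebraMap A B)) fun p q h => ?_
  exact Ideal.IsIntegral.comap_lt_comap (R := A) (I := p.asIdeal) (J := q.asIdeal) h

theorem RingHom.IsIntegral.quotientMap {A B : Type*} [CommRing A] [CommRing B] {f : A →+* B}
    (hf : f.IsIntegral) {I : Ideal A} {J : Ideal B} (h : I ≤ J.comap f) :
    (Ideal.quotientMap J f h).IsIntegral := by
  refine RingHom.IsIntegral.tower_top (Ideal.Quotient.mk I) _ ?_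
  rw [Ideal.quotientMap_comp_mk]
  exact hf.trans _ _ ((Ideal.Quotient.mk J).isIntegral_of_surjective Ideal.Quotient.mk_surjective)

theorem MvPolynomial.isIntegral_map {K k : Type*} [Field K] [Field k] [Algebra K k]
    [Algebra.IsAlgebraic K k] (σ : Type*) :
    (map (algebraMap K k) : MvPolynomial σ K →+* MvPolynomial σ k).IsIntegral := by
  let _ : Algebra (MvPolynomial σ K) (MvPolynomial σ k) := MvPolynomial.algebraMvPolynomial
  have : Algebra.IsIntegral (MvPolynomial σ K) (MvPolynomial σ k) := inferInstance
  exact this.isIntegral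

theorem RingHom.IsIntegral.exists_isPrime_le_comap_eq {R A : Type*} [CommRing R] [IsDomain R]
    [IsIntegrallyClosed R] [CommRing A] [IsDomain A] {f : R →+* A} (hf : f.IsIntegral)
    (hinj : Function.Injective f) {P : Ideal R} [P.IsPrime] {m : Ideal A} [m.IsPrime]
    (h : P ≤ m.comap f) : ∃ P' ≤ m, P'.IsPrime ∧ P'.comap f = P := by
  algebraize [f]
  have : FaithfulSMul R A := (faithfulSMul_iff_algebraMap_injective R A).mpr hinj
  have : m.LiesOver (m.under R) := ⟨rfl⟩
  obtain ⟨P', hle, hp, ho⟩ := Ideal.exists_ideal_le_liesOver_of_le m h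
  exact ⟨P', hle, hp, ho.over.symm⟩

theorem RingHom.IsIntegral.height_comap_le {R A : Type*} [CommRing R] [IsDomain R]
    [IsNoetherianRing R] [IsIntegrallyClosed R] [CommRing A] [IsDomain A] [IsNoetherianRing A]
    {f : R →+* A} (hf : f.IsIntegral)
    (hinj : Function.Injective f) {m : Ideal A} [m.IsPrime] :
    (m.comap f).height ≤ m.height := by
  algebraize [f]
  have : FaithfulSMul R A := (faithfulSMul_iff_algebraMap_injective R A).mpr hinj
  have : m.LiesOver (m.comap f) := ⟨rfl⟩
  rw [Ideal.height_eq_height_add_of_liesOver_of_hasGoingDown (m.comap f) m]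
  exact le_self_add

variable {K k : Type*} [Field K] [Field k] [Algebra K k] [Algebra.IsAlgebraic K k] {n : ℕ}

theorem ringKrullDim_le_height_map_quotientMk {P : Ideal (MvPolynomial (Fin n) K)} [P.IsPrime]
    {P' m : Ideal (MvPolynomial (Fin n) k)} [P'.IsPrime] [m.IsMaximal]
    (hP' : P'.comap (map (algebraMap K k)) = P) (hm : P' ≤ m) :
    ringKrullDim (MvPolynomial (Fin n) K ⧸ P) ≤ (m.map (Ideal.Quotient.mk P')).height := by
  obtain ⟨s, -, g, hg, hgi⟩ := exists_integral_inj_algHom_of_quotient P Ideal.IsPrime.ne_top'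
  let ψ : MvPolynomial (Fin n) K ⧸ P →+* MvPolynomial (Fin n) k ⧸ P' :=
    Ideal.quotientMap P' (map (algebraMap K k)) hP'.ge
  have hψ : Function.Injective ψ := Ideal.quotientMap_injective' hP'.le
  have hψi : ψ.IsIntegral := (isIntegral_map (Fin n)).quotientMap _
  have hmax : (m.map (Ideal.Quotient.mk P')).IsMaximal :=
    .map_of_surjective_of_ker_le Ideal.Quotient.mk_surjective (by rwa [Ideal.mk_ker])
  have hi : (ψ.comp g.toRingHom).IsIntegral := RingHom.IsIntegral.trans _ _ hgi hψi
  have hinj : Function.Injective (ψ.comp g.toRingHom) := hψ.comp hg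
  have hcm := Ideal.isMaximal_comap_of_isIntegral_of_isMaximal' _ hi
    (m.map (Ideal.Quotient.mk P'))
  have h1 := hi.height_comap_le hinj (m := m.map (Ideal.Quotient.mk P'))
  rw [MvPolynomial.height_eq_of_isMaximal] at h1
  refine (ringKrullDim_le_of_isIntegral g.toRingHom hgi).trans ?_
  rw [MvPolynomial.ringKrullDim_of_isNoetherianRing, ringKrullDim_eq_zero_of_field, zero_add]
  simpa using WithBot.coe_le_coe.mpr h1

end LyingOver

section KrullSeparation

theorem Ideal.exists_isPrime_lt_of_card_lt_height {B : Type*} [CommRing B] [IsNoetherianRing B]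
    {m : Ideal B} [m.IsPrime] {s : Finset B} (hs : (s : Set B) ⊆ m) (h : s.card < m.height) :
    ∃ Q < m, Q.IsPrime ∧ (s : Set B) ⊆ Q := by
  obtain ⟨Q, hQ, hQm⟩ := Ideal.exists_minimalPrimes_le (Ideal.span_le.mpr hs)
  refine ⟨Q, lt_of_le_of_ne hQm ?_, hQ.1.1, Ideal.span_le.mp hQ.1.2⟩
  rintro rfl
  exact h.not_ge (Ideal.height_le_card_of_mem_minimalPrimes_span_finset hQ)

theorem Ideal.exists_isPrime_between_of_card_lt_height {B : Type*} [CommRing B]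
    [IsNoetherianRing B] {P m : Ideal B} [m.IsPrime] (hPm : P ≤ m) {s : Finset B}
    (hs : (s : Set B) ⊆ m) (h : s.card < (m.map (Ideal.Quotient.mk P)).height) :
    ∃ Q < m, Q.IsPrime ∧ P ≤ Q ∧ (s : Set B) ⊆ Q := by
  classical
  have hprime : (m.map (Ideal.Quotient.mk P)).IsPrime := Ideal.isPrime_map_quotientMk_of_isPrime hPm
  have hcomap : (m.map (Ideal.Quotient.mk P)).comap (Ideal.Quotient.mk P) = m := by
    rw [Ideal.comap_map_of_surjective' _ Ideal.Quotient.mk_surjective, Ideal.mk_ker,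
      sup_eq_left.mpr hPm]
  obtain ⟨Q, hQm, hQ, hsQ⟩ := Ideal.exists_isPrime_lt_of_card_lt_height
    (m := m.map (Ideal.Quotient.mk P)) (s := s.image (Ideal.Quotient.mk P))
    (by
      rw [Finset.coe_image, Set.image_subset_iff]
      exact fun x hx => Ideal.mem_map_of_mem _ (hs hx))
    (lt_of_le_of_lt (by exact_mod_cast Finset.card_image_le) h)
  refine ⟨Q.comap (Ideal.Quotient.mk P), ?_, inferInstance, ?_, ?_⟩
  · refine lt_of_le_of_ne ((Ideal.comap_mono hQm.le).trans hcomap.le) fun he => hQm.not_ge ?_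
    rw [← he, Ideal.map_comap_of_surjective _ Ideal.Quotient.mk_surjective]
  · conv_lhs => rw [← Ideal.mk_ker (I := P)]
    exact Ideal.comap_mono bot_le
  · rw [Finset.coe_image, Set.image_subset_iff] at hsQ
    exact hsQ

theorem eq_vanishingIdeal_singleton_of_finite {k : Type*} [Field k] [IsAlgClosed k] {n : ℕ}
    {Q : Ideal (MvPolynomial (Fin n) k)} [Q.IsPrime] (hfin : (zeroLocus k Q).Finite)
    {p : Fin n → k} (hp : Q ≤ vanishingIdeal k {p}) : Q = vanishingIdeal k {p} := by
  classical
  have hQ := MvPolynomial.IsPrime.vanishingIdeal_zeroLocus (K := k) Q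
  have h : (hfin.toFinset.inf fun z => vanishingIdeal k {z}) ≤ Q := by
    conv_rhs => rw [← hQ]
    intro f hf
    rw [mem_vanishingIdeal_iff]
    intro x hx
    rw [Submodule.mem_finsetInf] at hf
    exact (mem_vanishingIdeal_iff.mp (hf x (by simpa using hx))) x rfl
  obtain ⟨z, hz, hzQ⟩ := (Ideal.IsPrime.inf_le' ‹_›).mp h
  have hmax : (vanishingIdeal k {z} : Ideal (MvPolynomial (Fin n) k)).IsMaximal := inferInstance
  have hmax' : (vanishingIdeal k {p} : Ideal (MvPolynomial (Fin n) k)).IsMaximal := inferInstance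
  have := hmax.eq_of_le hmax'.ne_top (hzQ.trans hp)
  exact le_antisymm hp (this ▸ hzQ)

end KrullSeparation

section Independence

theorem Polynomial.exists_forall_eq_X_pow_mul {k ι : Type*} [Field k] {Z : Finset ι}
    (f : ι → Polynomial k) {z₀ : ι} (hz₀ : z₀ ∈ Z) (h : f z₀ ≠ 0) :
    ∃ (s : ℕ) (g : ι → Polynomial k), (∀ z ∈ Z, f z = Polynomial.X ^ s * g z) ∧
      ∃ z ∈ Z, (g z).eval 0 ≠ 0 := by
  classical
  have hex : ∃ s, ∃ z ∈ Z, ¬ (Polynomial.X ^ (s + 1) ∣ f z) := by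
    refine ⟨(f z₀).natDegree, z₀, hz₀, fun hd => h ?_⟩
    have := (Polynomial.X_pow_dvd_iff.mp hd) _ (Nat.lt_succ_self _)
    simpa using this
  obtain ⟨z₁, hz₁, hnd⟩ := Nat.find_spec hex
  have hdvd : ∀ z ∈ Z, Polynomial.X ^ (Nat.find hex) ∣ f z := by
    intro z hz
    by_contra hc
    rcases hs : Nat.find hex with _ | s
    · rw [hs] at hc; simp at hc
    · have := Nat.find_min hex (m := s) (by omega)
      push Not at this
      rw [hs] at hc
      exact hc (this z hz)
  choose! g hg using hdvd
  refine ⟨_, g, hg, z₁, hz₁, fun h0 => hnd ?_⟩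
  rw [hg z₁ hz₁, pow_succ]
  refine mul_dvd_mul_left _ (Polynomial.X_dvd_iff.mpr ?_)
  rwa [Polynomial.coeff_zero_eq_eval_zero]

theorem MvPolynomial.aeval_sub_aeval_mem {k A σ : Type*} [CommRing k] [CommRing A] [Algebra k A]
    {Q : Ideal A} {u v : σ → A} (h : ∀ i, u i - v i ∈ Q) (q : MvPolynomial σ k) :
    aeval u q - aeval v q ∈ Q := by
  rw [← Ideal.Quotient.eq, ← Ideal.Quotient.mkₐ_eq_mk k, ← AlgHom.comp_apply, ← AlgHom.comp_apply,
    comp_aeval, comp_aeval]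
  congr 2
  funext i
  simpa using Ideal.Quotient.eq.mpr (h i)

variable {K k : Type*} [Field K] [Field k] [Algebra K k] [Algebra.IsAlgebraic K k] {n : ℕ}

theorem exists_isPrime_le_vanishingIdeal {P : Ideal (MvPolynomial (Fin n) K)} [P.IsPrime]
    {z : Fin n → k} (hz : ∀ f ∈ P, aeval z f = 0) :
    ∃ P' ≤ (vanishingIdeal k {z} : Ideal (MvPolynomial (Fin n) k)), P'.IsPrime ∧
      P'.comap (map (algebraMap K k)) = P := by
  refine (isIntegral_map (K := K) (k := k) (Fin n)).exists_isPrime_le_comap_eq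
    (map_injective _ (algebraMap K k).injective) fun f hf => ?_
  simpa [mem_vanishingIdeal_singleton_iff, aeval_map_algebraMap] using hz f hf

theorem eq_zero_of_sum_mul_aeval_mem [IsAlgClosed k] {P : Ideal (MvPolynomial (Fin n) K)}
    [P.IsPrime] {r : ℕ} (hdim : (r : WithBot ℕ∞) ≤ ringKrullDim (MvPolynomial (Fin n) K ⧸ P))
    (L : Fin r → MvPolynomial (Fin n) k) {Z : Finset (Fin n → k)}
    (hZ : ∀ x, x ∈ Z ↔ (∀ f ∈ P, aeval x f = 0) ∧ ∀ i, aeval x (L i) = 0)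
    (h : (Fin n → k) → MvPolynomial (Fin n) k) (hself : ∀ z ∈ Z, aeval z (h z) ≠ 0)
    (hother : ∀ z ∈ Z, ∀ w ∈ Z, w ≠ z → aeval w (h z) = 0)
    (q : (Fin n → k) → MvPolynomial (Fin r) k)
    (hsum : ∀ P' : Ideal (MvPolynomial (Fin n) k), P'.IsPrime →
      P'.comap (map (algebraMap K k)) = P → ∑ z ∈ Z, h z * aeval L (q z) ∈ P') :
    ∀ z ∈ Z, q z = 0 := by
  classical
  have : Infinite k := IsAlgClosed.instInfinite
  by_contra! hne
  obtain ⟨z₀, hz₀, hq⟩ := hne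
  rcases Nat.eq_zero_or_pos r with rfl | hr
  · obtain ⟨P', hP'm, hP', hcomap⟩ := exists_isPrime_le_vanishingIdeal ((hZ z₀).mp hz₀).1
    have hmem := (mem_vanishingIdeal_singleton_iff _ _).mp (hP'm (hsum P' hP' hcomap))
    rw [map_sum, Finset.sum_eq_single z₀ (fun w hw hwz => by
      rw [map_mul, hother w hw z₀ hz₀ hwz.symm, zero_mul]) (fun hc => absurd hz₀ hc), map_mul] at hmem
    rcases mul_eq_zero.mp hmem with hc | hc
    · exact hself z₀ hz₀ hc
    · refine hq (MvPolynomial.funext fun x => ?_)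
      rw [← AlgHom.comp_apply, comp_aeval, Subsingleton.elim (fun i => aeval z₀ (L i)) x] at hc
      simpa [← aeval_eq_eval] using hc
  let i₀ : Fin r := ⟨0, hr⟩
  obtain ⟨a, ha⟩ : ∃ a : Fin r → k, eval a (q z₀ * X i₀) ≠ 0 := by
    by_contra! hc
    exact mul_ne_zero hq (X_ne_zero i₀) (MvPolynomial.funext fun x => by simpa using hc x)
  rw [map_mul, eval_X] at ha
  have ha₀ : a i₀ ≠ 0 := right_ne_zero_of_mul ha
  have haq : eval a (q z₀) ≠ 0 := left_ne_zero_of_mul ha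
  let f : (Fin n → k) → Polynomial k := fun z =>
    aeval (fun i => Polynomial.C (a i) * Polynomial.X) (q z)
  have hf : f z₀ ≠ 0 := fun hc => haq <| by
    have := congrArg (Polynomial.aeval (1 : k)) hc
    simpa [f, ← AlgHom.comp_apply, comp_aeval, aeval_eq_eval] using this
  obtain ⟨s, g, hg, z₁, hz₁, hg₁⟩ := Polynomial.exists_forall_eq_X_pow_mul f hz₀ hf
  obtain ⟨P', hP'm, hP', hcomap⟩ := exists_isPrime_le_vanishingIdeal ((hZ z₁).mp hz₁).1
  let τ : MvPolynomial (Fin n) k := C (a i₀)⁻¹ * L i₀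
  have hτ : C (a i₀) * τ = L i₀ := by
    rw [← mul_assoc, ← C_mul, mul_inv_cancel₀ ha₀, C_1, one_mul]
  have hτz : aeval z₁ τ = 0 := by simp only [τ, map_mul, ((hZ z₁).mp hz₁).2, mul_zero]
  let S : Finset (MvPolynomial (Fin n) k) :=
    (Finset.univ.erase i₀).image fun i => L i - C (a i) * τ
  have hScard : S.card < r := by
    refine lt_of_le_of_lt Finset.card_image_le ?_
    rw [Finset.card_erase_of_mem (Finset.mem_univ _), Finset.card_univ, Fintype.card_fin]
    omega
  have hmax : (vanishingIdeal k {z₁} : Ideal (MvPolynomial (Fin n) k)).IsMaximal := inferInstance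
  have hht := WithBot.coe_le_coe.mp
    (hdim.trans (ringKrullDim_le_height_map_quotientMk hcomap hP'm))
  obtain ⟨Q, hQm, hQ, hP'Q, hSQ⟩ := Ideal.exists_isPrime_between_of_card_lt_height hP'm (s := S)
    (by
      intro x hx
      obtain ⟨i, -, rfl⟩ := Finset.mem_image.mp (Finset.mem_coe.mp hx)
      rw [SetLike.mem_coe, mem_vanishingIdeal_singleton_iff, map_sub, map_mul, hτz,
        ((hZ z₁).mp hz₁).2, mul_zero, sub_zero])
    (lt_of_lt_of_le (by exact_mod_cast hScard) hht)
  have hL : ∀ i, L i - C (a i) * τ ∈ Q := by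
    intro i
    by_cases hi : i = i₀
    · rw [hi, hτ, sub_self]; exact Q.zero_mem
    · exact hSQ (Finset.mem_coe.mpr (Finset.mem_image.mpr ⟨i, by simp [hi], rfl⟩))
  have hτQ : τ ∉ Q := by
    intro hτQ
    refine hQm.ne (eq_vanishingIdeal_singleton_of_finite (Z.finite_toSet.subset fun x hx => ?_)
      hQm.le)
    rw [mem_zeroLocus_iff] at hx
    refine Finset.mem_coe.mpr ((hZ x).mpr ⟨fun p hp => ?_, fun i => hx _ ?_⟩)
    · rw [← aeval_map_algebraMap k]
      exact hx _ (hP'Q (by rwa [← hcomap] at hp))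
    · have := Q.add_mem (hL i) (Q.mul_mem_left (C (a i)) hτQ)
      rwa [sub_add_cancel] at this
  have hcongr : ∀ z ∈ Z, aeval L (q z) - τ ^ s * Polynomial.aeval τ (g z) ∈ Q := by
    intro z hz
    have h1 : τ ^ s * Polynomial.aeval τ (g z) = aeval (fun i => C (a i) * τ) (q z) := by
      have := congrArg (Polynomial.aeval τ) (hg z hz)
      rw [map_mul, map_pow, Polynomial.aeval_X] at this
      rw [← this, ← AlgHom.comp_apply, comp_aeval]
      simp [algebraMap_eq]
    rw [h1]
    exact aeval_sub_aeval_mem hL (q z)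
  have hmem : τ ^ s * ∑ z ∈ Z, h z * Polynomial.aeval τ (g z) ∈ Q := by
    have h2 : ∑ z ∈ Z, h z * (aeval L (q z) - τ ^ s * Polynomial.aeval τ (g z)) ∈ Q :=
      Q.sum_mem fun z hz => Q.mul_mem_left _ (hcongr z hz)
    have h3 := Q.sub_mem (hP'Q (hsum P' hP' hcomap)) h2
    rw [← Finset.sum_sub_distrib] at h3
    rw [Finset.mul_sum]
    convert h3 using 2
    ring
  have hmem' := hQm.le ((hQ.mem_or_mem hmem).resolve_left fun hc => hτQ (hQ.mem_of_pow_mem _ hc))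
  rw [mem_vanishingIdeal_singleton_iff, map_sum, Finset.sum_eq_single z₁ (fun w hw hwz => by
      rw [map_mul, hother w hw z₁ hz₁ hwz.symm, zero_mul]) (fun hc => absurd hz₁ hc), map_mul] at hmem'
  rcases mul_eq_zero.mp hmem' with hc | hc
  · exact hself z₁ hz₁ hc
  · rw [← Polynomial.aeval_algHom_apply, hτz] at hc
    exact hg₁ (by simpa using hc)

end Independence

section LowerBound

theorem MvPolynomial.totalDegree_aeval_le {k σ τ : Type*} [CommRing k] {L : σ → MvPolynomial τ k}
    (hL : ∀ i, (L i).totalDegree ≤ 1) (q : MvPolynomial σ k) :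
    (aeval L q).totalDegree ≤ q.totalDegree := by
  rw [aeval_def, eval₂_eq]
  refine totalDegree_finsetSum_le fun d hd => ?_
  refine (totalDegree_mul _ _).trans ?_
  rw [algebraMap_eq, totalDegree_C, zero_add]
  refine (totalDegree_finsetProd _ _).trans (le_trans ?_ (le_totalDegree hd))
  refine Finset.sum_le_sum fun i _ => (totalDegree_pow _ _).trans ?_
  simpa using Nat.mul_le_mul_left (d i) (hL i)

theorem MvPolynomial.exists_separating {k : Type*} [Field k] {n : ℕ} (Z : Finset (Fin n → k)) :
    ∃ h : (Fin n → k) → MvPolynomial (Fin n) k, (∀ z ∈ Z, aeval z (h z) ≠ 0) ∧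
      ∀ z ∈ Z, ∀ w ∈ Z, w ≠ z → aeval w (h z) = 0 := by
  classical
  have hex : ∀ z w : Fin n → k, ∃ l : MvPolynomial (Fin n) k, w ≠ z →
      aeval z l ≠ 0 ∧ aeval w l = 0 := by
    intro z w
    by_cases hwz : w = z
    · exact ⟨0, fun hc => absurd hwz hc⟩
    · obtain ⟨j, hj⟩ := Function.ne_iff.mp hwz
      exact ⟨X j - C (w j), fun _ => ⟨by simpa [sub_eq_zero] using Ne.symm hj, by simp⟩⟩
  choose l hl using hex
  refine ⟨fun z => ∏ w ∈ Z.erase z, l z w, fun z _ => ?_, fun z _ w hw hwz => ?_⟩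
  · rw [map_prod]
    exact Finset.prod_ne_zero_iff.mpr fun w hw => (hl z w (Finset.ne_of_mem_erase hw)).1
  · rw [map_prod]
    exact Finset.prod_eq_zero (Finset.mem_erase.mpr ⟨hwz, hw⟩) (hl z w hwz).2

theorem Ideal.exists_mem_iff_ne_of_minimalPrimes {R : Type*} [CommRing R] {I : Ideal R}
    {S : Finset (Ideal R)} (hS : ∀ P ∈ S, P ∈ I.minimalPrimes) :
    ∃ h : Ideal R → R, ∀ P ∈ S, ∀ P₂ ∈ S, h P ∈ P₂ ↔ P₂ ≠ P := by
  classical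
  have hex : ∀ P ∈ S, ∃ h : R, ∀ P₂ ∈ S, h ∈ P₂ ↔ P₂ ≠ P := by
    intro P hP
    have hprime : P.IsPrime := (hS P hP).1.1
    have hnot : ¬ (S.erase P).inf id ≤ P := by
      rw [Ideal.IsPrime.inf_le' hprime]
      rintro ⟨q, hq, hqP⟩
      rw [Finset.mem_erase] at hq
      exact hq.1 (le_antisymm hqP ((hS P hP).2 (hS q hq.2).1 hqP))
    obtain ⟨x, hx, hxP⟩ := SetLike.not_le_iff_exists.mp hnot
    rw [Submodule.mem_finsetInf] at hx
    refine ⟨x, fun P₂ hP₂ => ⟨?_, fun hne => hx P₂ (Finset.mem_erase.mpr ⟨hne, hP₂⟩)⟩⟩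
    rintro hxP₂ rfl
    exact hxP hxP₂
  choose! h hh using hex
  exact ⟨h, hh⟩

variable {K k : Type*} [Field K] [Field k] [Algebra K k] [Algebra.IsAlgebraic K k] {n : ℕ}

theorem eq_zero_of_sum_mem_radical [IsAlgClosed k] {I : Ideal (MvPolynomial (Fin n) K)} {r : ℕ}
    {S : Finset (Ideal (MvPolynomial (Fin n) K))} (hS : ∀ P ∈ S, P ∈ I.minimalPrimes)
    (hdim : ∀ P ∈ S, (r : WithBot ℕ∞) ≤ ringKrullDim (MvPolynomial (Fin n) K ⧸ P))
    {L : Ideal (MvPolynomial (Fin n) K) → Fin r → MvPolynomial (Fin n) k}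
    {Z : Ideal (MvPolynomial (Fin n) K) → Finset (Fin n → k)}
    (hZ : ∀ P ∈ S, ∀ x, x ∈ Z P ↔ (∀ f ∈ P, aeval x f = 0) ∧ ∀ i, aeval x (L P i) = 0)
    {g : Ideal (MvPolynomial (Fin n) K) → MvPolynomial (Fin n) K}
    (hg : ∀ P ∈ S, ∀ P₂ ∈ S, g P ∈ P₂ ↔ P₂ ≠ P)
    {h : Ideal (MvPolynomial (Fin n) K) → (Fin n → k) → MvPolynomial (Fin n) k}
    (hself : ∀ P, ∀ z ∈ Z P, aeval z (h P z) ≠ 0)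
    (hother : ∀ P, ∀ z ∈ Z P, ∀ w ∈ Z P, w ≠ z → aeval w (h P z) = 0)
    {q : Ideal (MvPolynomial (Fin n) K) → (Fin n → k) → MvPolynomial (Fin r) k}
    (hmem : ∑ P ∈ S, map (algebraMap K k) (g P) * ∑ z ∈ Z P, h P z * aeval (L P) (q P z) ∈
      (I.map (map (algebraMap K k))).radical) :
    ∀ P ∈ S, ∀ z ∈ Z P, q P z = 0 := by
  classical
  intro P hP
  have hprime : P.IsPrime := (hS P hP).1.1
  refine eq_zero_of_sum_mul_aeval_mem (hdim P hP) (L P) (hZ P hP) (h P) (hself P) (hother P) (q P)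
    fun P' hP' hcomap => ?_
  have hle : (I.map (map (algebraMap K k))).radical ≤ P' :=
    hP'.radical_le_iff.mpr (Ideal.map_le_iff_le_comap.mpr (hcomap ▸ (hS P hP).1.2))
  have hsum := hle hmem
  rw [← Finset.add_sum_erase _ _ hP] at hsum
  have hrest : ∑ P₂ ∈ S.erase P, map (algebraMap K k) (g P₂) *
      ∑ z ∈ Z P₂, h P₂ z * aeval (L P₂) (q P₂ z) ∈ P' := by
    refine P'.sum_mem fun P₂ hP₂ => P'.mul_mem_right _ ?_
    rw [Finset.mem_erase] at hP₂
    have : g P₂ ∈ P'.comap (map (algebraMap K k)) :=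
      hcomap ▸ (hg P₂ hP₂.2 P hP).mpr hP₂.1.symm
    exact this
  refine (hP'.mem_or_mem ((P'.add_mem_iff_left hrest).mp hsum)).resolve_left fun hc => ?_
  have : g P ∈ P'.comap (map (algebraMap K k)) := hc
  rw [hcomap] at this
  exact (hg P hP P hP).mp this rfl

theorem hilbGrowth_radical_map [IsAlgClosed k] {I : Ideal (MvPolynomial (Fin n) K)} {r : ℕ}
    {S : Finset (Ideal (MvPolynomial (Fin n) K))} (hS : ∀ P ∈ S, P ∈ I.minimalPrimes)
    (hdim : ∀ P ∈ S, (r : WithBot ℕ∞) ≤ ringKrullDim (MvPolynomial (Fin n) K ⧸ P))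
    {L : Ideal (MvPolynomial (Fin n) K) → Fin r → MvPolynomial (Fin n) k}
    (hL : ∀ P i, (L P i).totalDegree ≤ 1)
    {Z : Ideal (MvPolynomial (Fin n) K) → Finset (Fin n → k)}
    (hZ : ∀ P ∈ S, ∀ x, x ∈ Z P ↔ (∀ f ∈ P, aeval x f = 0) ∧ ∀ i, aeval x (L P i) = 0) :
    HilbGrowth (I.map (map (algebraMap K k))).radical r (∑ P ∈ S, (Z P).card) 1 := by
  classical
  obtain ⟨g, hg⟩ := Ideal.exists_mem_iff_ne_of_minimalPrimes hS
  choose h hself hother using fun P => MvPolynomial.exists_separating (Z P)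
  set J := (I.map (map (algebraMap K k))).radical with hJ
  let T := S.sigma Z
  let H : (Σ _ : Ideal (MvPolynomial (Fin n) K), Fin n → k) → MvPolynomial (Fin n) k :=
    fun i => map (algebraMap K k) (g i.1) * h i.1 i.2
  let δ := T.sup fun i => (H i).totalDegree
  refine ⟨δ, fun t => ?_⟩
  let W := restrictTotalDegree (Fin r) k t
  let Φ₀ : (T → W) →ₗ[k] MvPolynomial (Fin n) k := ∑ i : T,
    (LinearMap.mulLeft k (H i)) ∘ₗ (aeval (L i.1.1)).toLinearMap ∘ₗ W.subtype ∘ₗ LinearMap.proj i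
  have hΦ₀ : ∀ v, Φ₀ v = ∑ i : T, H i * aeval (L i.1.1) (v i : MvPolynomial (Fin r) k) := by
    intro v
    simp [Φ₀]
  let Φ : (T → W) →ₗ[k] MvPolynomial (Fin n) k ⧸ J := (Ideal.Quotient.mkₐ k J).toLinearMap ∘ₗ Φ₀
  have hrange : ∀ v, Φ v ∈
      (restrictTotalDegree (Fin n) k (t + δ)).map (Ideal.Quotient.mkₐ k J).toLinearMap := by
    intro v
    refine Submodule.mem_map_of_mem ?_
    rw [hΦ₀]
    refine Submodule.sum_mem _ fun i _ => ?_
    rw [mem_restrictTotalDegree]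
    refine (totalDegree_mul _ _).trans ?_
    have h1 : (H i).totalDegree ≤ δ := Finset.le_sup (f := fun i => (H i).totalDegree) i.2
    have h2 := (totalDegree_aeval_le (hL i.1.1) (v i : MvPolynomial (Fin r) k)).trans
      ((mem_restrictTotalDegree _ _ _).mp (v i).2)
    omega
  have hinj : Function.Injective Φ := by
    rw [← LinearMap.ker_eq_bot, LinearMap.ker_eq_bot']
    intro v hv
    have hv' : Φ₀ v ∈ J := Ideal.Quotient.eq_zero_iff_mem.mp hv
    let q : Ideal (MvPolynomial (Fin n) K) → (Fin n → k) → MvPolynomial (Fin r) k :=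
      fun P z => if hi : (⟨P, z⟩ : Σ _ : Ideal (MvPolynomial (Fin n) K), Fin n → k) ∈ T then
        (v ⟨_, hi⟩ : MvPolynomial (Fin r) k) else 0
    have hq : ∀ i : T, q i.1.1 i.1.2 = v i := fun i => dif_pos i.2
    have hsum : Φ₀ v = ∑ P ∈ S, map (algebraMap K k) (g P) *
        ∑ z ∈ Z P, h P z * aeval (L P) (q P z) := by
      rw [hΦ₀, ← Finset.sum_congr rfl fun i _ => by rw [← hq i],
        Finset.sum_coe_sort T fun i => H i * aeval (L i.1) (q i.1 i.2), Finset.sum_sigma]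
      refine Finset.sum_congr rfl fun P _ => ?_
      rw [Finset.mul_sum]
      exact Finset.sum_congr rfl fun z _ => mul_assoc _ _ _
    rw [hsum] at hv'
    have hzero := eq_zero_of_sum_mem_radical hS hdim hZ hg hself hother hv'
    funext i
    have hi := Finset.mem_sigma.mp i.2
    have := hzero i.1.1 hi.1 i.1.2 hi.2
    rw [hq i] at this
    exact Subtype.ext this
  have hfinW : Module.Finite k W := inferInstance
  have hfin : Module.Finite k
      ((restrictTotalDegree (Fin n) k (t + δ)).map (Ideal.Quotient.mkₐ k J).toLinearMap) :=
    inferInstance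
  have hle := LinearMap.finrank_le_finrank_of_injective
    (f := Φ.codRestrict _ hrange) ((LinearMap.injective_codRestrict_iff ..).mpr hinj)
  rw [Module.finrank_pi_fintype, Finset.sum_const, finrank_restrictTotalDegree, Finset.card_univ,
    Fintype.card_coe, Finset.card_sigma, smul_eq_mul] at hle
  have hpow : t ^ r ≤ r.factorial * (r + t).choose r := by
    rw [← Nat.descFactorial_eq_factorial_mul_choose]
    exact le_trans (Nat.pow_le_pow_left (by omega) r) (Nat.pow_sub_le_descFactorial (r + t) r)
  calc (∑ P ∈ S, (Z P).card) * t ^ r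
      ≤ (∑ P ∈ S, (Z P).card) * (r.factorial * (r + t).choose r) := Nat.mul_le_mul_left _ hpow
    _ = r.factorial * ((∑ P ∈ S, (Z P).card) * (r + t).choose r) := by ring
    _ ≤ 1 * r.factorial * affineHilb J (t + δ) := by
      rw [one_mul]
      exact Nat.mul_le_mul_left _ hle

end LowerBound

section Degree

variable {K : Type*} [Field K] {n : ℕ}

/-- The affine form with constant term `a` and coefficients `c`. -/
noncomputable def affineForm {k : Type*} [Field k] (c : Fin n → k) (a : k) :
    MvPolynomial (Fin n) k :=
  C a + ∑ j, C (c j) * X j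

theorem totalDegree_affineForm_le {k : Type*} [Field k] (c : Fin n → k) (a : k) :
    (affineForm c a).totalDegree ≤ 1 := by
  refine (totalDegree_add _ _).trans (max_le (by simp) ?_)
  refine totalDegree_finsetSum_le fun j _ => (totalDegree_mul _ _).trans ?_
  simp

theorem mem_hyperplaneSection_iff (P : Ideal (MvPolynomial (Fin n) K)) {d : ℕ}
    (c : Fin d → Fin n → AlgebraicClosure K) (c₀ : Fin d → AlgebraicClosure K)
    (x : Fin n → AlgebraicClosure K) :
    x ∈ zeroSet P ∩ {x | ∀ i, c₀ i + ∑ j, c i j * x j = 0} ↔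
      (∀ f ∈ P, aeval x f = 0) ∧ ∀ i, aeval x (affineForm (c i) (c₀ i)) = 0 := by
  simp [zeroSet, affineForm]

theorem exists_card_eq_primeDeg {P : Ideal (MvPolynomial (Fin n) K)} {d : ℕ}
    (h0 : primeDeg P d ≠ 0) (htop : primeDeg P d < ⊤) :
    ∃ (L : Fin d → MvPolynomial (Fin n) (AlgebraicClosure K))
      (Z : Finset (Fin n → AlgebraicClosure K)), (∀ i, (L i).totalDegree ≤ 1) ∧
      (∀ x, x ∈ Z ↔ (∀ f ∈ P, aeval x f = 0) ∧ ∀ i, aeval x (L i) = 0) ∧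
      primeDeg P d = Z.card := by
  have hne : {N : ℕ∞ | ∃ (c : Fin d → Fin n → AlgebraicClosure K)
      (c₀ : Fin d → AlgebraicClosure K),
      (zeroSet P ∩ {x | ∀ i, c₀ i + ∑ j, c i j * x j = 0}).Finite ∧
      N = Nat.card ↥(zeroSet P ∩ {x | ∀ i, c₀ i + ∑ j, c i j * x j = 0})}.Nonempty := by
    rw [Set.nonempty_iff_ne_empty]
    intro he
    rw [primeDeg, he] at h0
    simp at h0
  have := hne.to_subtype
  obtain ⟨c, c₀, hfin, hN⟩ := ENat.sSup_mem_of_nonempty_of_lt_top htop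
  refine ⟨fun i => affineForm (c i) (c₀ i), hfin.toFinset, fun i => totalDegree_affineForm_le _ _,
    fun x => ?_, ?_⟩
  · rw [hfin.mem_toFinset, mem_hyperplaneSection_iff]
  · rw [primeDeg, hN, Nat.card_coe_set_eq, Set.ncard_eq_toFinset_card _ hfin]

theorem sum_card_le_prod_totalDegree {m r : ℕ} (hm : n - r ≤ m)
    (F : Fin m → MvPolynomial (Fin n) K)
    (hdim : ringKrullDim (MvPolynomial (Fin n) K ⧸ Ideal.span (Set.range F)) = r)
    (hsorted : ∀ i j : Fin m, i ≤ j → (F j).totalDegree ≤ (F i).totalDegree)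
    {S : Finset (Ideal (MvPolynomial (Fin n) K))}
    (hS : ∀ P ∈ S, P ∈ (Ideal.span (Set.range F)).minimalPrimes ∧
      ringKrullDim (MvPolynomial (Fin n) K ⧸ P) = r)
    {L : Ideal (MvPolynomial (Fin n) K) → Fin r → MvPolynomial (Fin n) (AlgebraicClosure K)}
    (hL : ∀ P i, (L P i).totalDegree ≤ 1)
    {Z : Ideal (MvPolynomial (Fin n) K) → Finset (Fin n → AlgebraicClosure K)}
    (hZ : ∀ P ∈ S, ∀ x, x ∈ Z P ↔ (∀ f ∈ P, aeval x f = 0) ∧ ∀ i, aeval x (L P i) = 0) :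
    ∑ P ∈ S, (Z P).card ≤ ∏ i : Fin (n - r), (F (Fin.castLE hm i)).totalDegree := by
  have : Infinite (AlgebraicClosure K) := IsAlgClosed.instInfinite
  let φ : MvPolynomial (Fin n) K →+* MvPolynomial (Fin n) (AlgebraicClosure K) :=
    map (algebraMap K (AlgebraicClosure K))
  have hφ : ∀ f, (φ f).totalDegree = f.totalDegree := fun f => by
    rw [totalDegree, support_map_of_injective f (algebraMap K (AlgebraicClosure K)).injective,
      totalDegree]
  have hspan : (Ideal.span (Set.range F)).map φ = Ideal.span (Set.range (φ ∘ F)) := by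
    rw [Ideal.map_span, Set.range_comp]
  have hr : r ≤ n := by
    have h := ringKrullDim_quotient_le (Ideal.span (Set.range F))
    rw [hdim, MvPolynomial.ringKrullDim_of_isNoetherianRing, ringKrullDim_eq_zero_of_field] at h
    simpa using h
  have hdim' : ringKrullDim (MvPolynomial (Fin n) (AlgebraicClosure K) ⧸
      Ideal.span (Set.range (φ ∘ F))) ≤ r := by
    rw [← hdim, ← hspan]
    exact ringKrullDim_le_of_isIntegral _ ((isIntegral_map (Fin n)).quotientMap Ideal.le_comap_map)
  have hgrowth := hilbGrowth_radical_map (fun P hP => (hS P hP).1)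
    (fun P hP => (hS P hP).2.ge) hL hZ
  have hle := HilbGrowth.le_prod_totalDegree (φ ∘ F) hr hm hdim'
    (fun i j hij => by simpa only [Function.comp_apply, hφ] using hsorted i j hij)
    (hspan ▸ hgrowth)
  simpa only [Function.comp_apply, hφ] using hle

end Degree

/-- **(Lazard.)** Let `F₁,…,F_m ∈ K[x₁,…,xₙ]` generate an ideal `I` of dimension `r`,
with `deg F₁ ≥ ⋯ ≥ deg F_m`.  Then `deg I ≤ ∏_{i=1}^{n-r} deg F_i`. -/
theorem stmt5 (K : Type*) [Field K] (n m r : ℕ) (hm : n - r ≤ m)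
    (F : Fin m → MvPolynomial (Fin n) K)
    (I : Ideal (MvPolynomial (Fin n) K)) (hI : I = Ideal.span (Set.range F))
    (hdim : ringKrullDim (MvPolynomial (Fin n) K ⧸ I) = r)
    (hsorted : ∀ i j : Fin m, i ≤ j → (F j).totalDegree ≤ (F i).totalDegree) :
    idealDeg I r ≤ ∏ i : Fin (n - r), ((F (Fin.castLE hm i)).totalDegree : ℕ∞) := by
  classical
  subst hI
  let D := ∏ i : Fin (n - r), (F (Fin.castLE hm i)).totalDegree
  have hcast : (∏ i : Fin (n - r), ((F (Fin.castLE hm i)).totalDegree : ℕ∞)) = (D : ℕ∞) := by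
    simp [D]
  rw [hcast]
  have hfin : {P : Ideal (MvPolynomial (Fin n) K) | P ∈ (Ideal.span (Set.range F)).minimalPrimes ∧
      ringKrullDim (MvPolynomial (Fin n) K ⧸ P) = r}.Finite :=
    (Ideal.finite_minimalPrimes_of_isNoetherianRing _ _).subset fun P hP => hP.1
  have hlt : ∀ P ∈ hfin.toFinset, primeDeg P r < ⊤ := by
    intro P hP
    refine lt_of_le_of_lt (sSup_le ?_) (ENat.natCast_lt_top D)
    rintro N ⟨c, c₀, hc, rfl⟩
    have h := sum_card_le_prod_totalDegree hm F hdim hsorted (S := {P})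
      (L := fun _ i => affineForm (c i) (c₀ i)) (Z := fun _ => hc.toFinset)
      (by simpa using hP) (fun _ _ => totalDegree_affineForm_le _ _) (by
        intro P' hP' x
        rw [Finset.mem_singleton.mp hP', hc.mem_toFinset, mem_hyperplaneSection_iff])
    rw [Finset.sum_singleton, ← Set.ncard_eq_toFinset_card _ hc, ← Nat.card_coe_set_eq] at h
    exact_mod_cast h
  let S := hfin.toFinset.filter fun P => primeDeg P r ≠ 0
  have hex : ∀ P, ∃ (L : Fin r → MvPolynomial (Fin n) (AlgebraicClosure K))
      (Z : Finset (Fin n → AlgebraicClosure K)), (∀ i, (L i).totalDegree ≤ 1) ∧ (P ∈ S →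
      (∀ x, x ∈ Z ↔ (∀ f ∈ P, aeval x f = 0) ∧ ∀ i, aeval x (L i) = 0) ∧
      primeDeg P r = Z.card) := by
    intro P
    by_cases hP : P ∈ S
    · obtain ⟨hP₁, hP₂⟩ := Finset.mem_filter.mp hP
      obtain ⟨L, Z, hL, hLZ⟩ := exists_card_eq_primeDeg hP₂ (hlt P hP₁)
      exact ⟨L, Z, hL, fun _ => hLZ⟩
    · exact ⟨0, ∅, by simp, fun hc => absurd hc hP⟩
  choose L Z hL hLZ using hex
  have hle := sum_card_le_prod_totalDegree hm F hdim hsorted (S := S)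
    (fun P hP => hfin.mem_toFinset.mp (Finset.mem_filter.mp hP).1) hL
    (fun P hP => (hLZ P hP).1)
  rw [idealDeg, finsum_mem_eq_finite_toFinset_sum _ hfin, ← Finset.sum_filter_ne_zero,
    Finset.sum_congr rfl fun P hP => (hLZ P hP).2]
  exact_mod_cast hle
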